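/- Let S be the operator on C²(Ω_r, ℂ) defined by Su = (1/((r²+a²)Σ + 2Ma²r sin²θ))·Pu with Pu = [−2ima(r²+a²)Σ ∂ₜ − a²sin²θ Δ∂ᵣ(Δ∂ᵣ) − ((r²+a²)²/sinθ)∂_θ(sinθ ∂_θ) + (m²Σ/sin²θ)(Σ + 2a²sin²θ)]u. Then for every C² function v on Ω_r, Sv = −(1/(2Σ̄))[a²sin²θ Δ D² + ((r²+a²)²/Δ) L²]v, where Σ̄ = (r²+a²)²/Δ − a²sin²θ. -/

import Mathlib

noncomputable section

/-- Functions of `(t, r, θ)`. -/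
abbrev F3 := ℝ × ℝ × ℝ → ℂ

/-- Partial derivative with respect to `t`. -/
noncomputable def dT (u : F3) (p : ℝ × ℝ × ℝ) : ℂ :=
  deriv (fun s => u (s, p.2.1, p.2.2)) p.1

/-- Partial derivative with respect to `r`. -/
noncomputable def dR (u : F3) (p : ℝ × ℝ × ℝ) : ℂ :=
  deriv (fun s => u (p.1, s, p.2.2)) p.2.1

/-- Partial derivative with respect to `θ`. -/
noncomputable def dTh (u : F3) (p : ℝ × ℝ × ℝ) : ℂ :=
  deriv (fun s => u (p.1, p.2.1, s)) p.2.2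

/-- `Δ = r² - 2Mr + a²`. -/
def Del (M a r : ℝ) : ℝ := r ^ 2 - 2 * M * r + a ^ 2

/-- `Σ = r² + a² cos² θ`. -/
def Sig (a r θ : ℝ) : ℝ := r ^ 2 + a ^ 2 * Real.cos θ ^ 2

/-- `r₊ = M + √(M² - a²)`. -/
noncomputable def rplus (M a : ℝ) : ℝ := M + Real.sqrt (M ^ 2 - a ^ 2)

/-- `Ω_r = ℝ × (r₊, ∞) × (0, π)`. -/
def OmegaR (M a : ℝ) : Set (ℝ × ℝ × ℝ) :=
  {p | rplus M a < p.2.1 ∧ 0 < p.2.2 ∧ p.2.2 < Real.pi}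

/-- The reduced Kerr wave operator `□ₘ`. -/
noncomputable def boxm (M a : ℝ) (m : ℤ) (u : F3) : F3 := fun p =>
  (Complex.ofReal (Sig a p.2.1 p.2.2))⁻¹ *
    (Complex.ofReal ((p.2.1 ^ 2 + a ^ 2) ^ 2 / Del M a p.2.1
        - a ^ 2 * Real.sin p.2.2 ^ 2) * dT (dT u) p
      + 4 * Complex.I * (m : ℂ) * Complex.ofReal M * Complex.ofReal a
          * Complex.ofReal p.2.1 / Complex.ofReal (Del M a p.2.1) * dT u p
      - dR (fun q => Complex.ofReal (Del M a q.2.1) * dR u q) p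
      - (Complex.ofReal (Real.sin p.2.2))⁻¹
          * dTh (fun q => Complex.ofReal (Real.sin q.2.2) * dTh u q) p
      - (m : ℂ) ^ 2 * Complex.ofReal (a ^ 2 / Del M a p.2.1
          - (Real.sin p.2.2 ^ 2)⁻¹) * u p)

/-- The Killing-tensor operator `□̄ₘ`. -/
noncomputable def barboxm (M a : ℝ) (m : ℤ) (u : F3) : F3 := fun p =>
  (Complex.ofReal (Sig a p.2.1 p.2.2))⁻¹ *
    (Complex.ofReal (a ^ 2 * (p.2.1 ^ 2 * Real.sin p.2.2 ^ 2
        + Real.cos p.2.2 ^ 2 * (p.2.1 ^ 2 + a ^ 2) ^ 2 / Del M a p.2.1)) * dT (dT u) p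
      + 2 * Complex.I * (m : ℂ) * Complex.ofReal a
          * Complex.ofReal (p.2.1 ^ 2 + a ^ 2 * Real.cos p.2.2 ^ 2
              * (p.2.1 ^ 2 + a ^ 2) / Del M a p.2.1) * dT u p
      - Complex.ofReal (a ^ 2 * Real.cos p.2.2 ^ 2)
          * dR (fun q => Complex.ofReal (Del M a q.2.1) * dR u q) p
      + Complex.ofReal (p.2.1 ^ 2 / Real.sin p.2.2)
          * dTh (fun q => Complex.ofReal (Real.sin q.2.2) * dTh u q) p
      - (m : ℂ) ^ 2 * Complex.ofReal (p.2.1 ^ 2 / Real.sin p.2.2 ^ 2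
          + a ^ 4 * Real.cos p.2.2 ^ 2 / Del M a p.2.1) * u p)

/-- The ladder operator `Dₙ`. -/
noncomputable def Dlad (M a : ℝ) (m n : ℤ) (u : F3) : F3 := fun p =>
  dR u p + (Complex.ofReal (Del M a p.2.1))⁻¹ *
      (Complex.ofReal (p.2.1 ^ 2 + a ^ 2) * dT u p
        + Complex.I * (m : ℂ) * Complex.ofReal a * u p)
    + Complex.ofReal (2 * (n : ℝ) * (p.2.1 - M) / Del M a p.2.1) * u p

/-- The ladder operator `Dₙ⁺`. -/
noncomputable def DladP (M a : ℝ) (m n : ℤ) (u : F3) : F3 := fun p =>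
  dR u p - (Complex.ofReal (Del M a p.2.1))⁻¹ *
      (Complex.ofReal (p.2.1 ^ 2 + a ^ 2) * dT u p
        + Complex.I * (m : ℂ) * Complex.ofReal a * u p)
    + Complex.ofReal (2 * (n : ℝ) * (p.2.1 - M) / Del M a p.2.1) * u p

/-- The ladder operator `Lₙ`. -/
noncomputable def Llad (a : ℝ) (m n : ℤ) (u : F3) : F3 := fun p =>
  dTh u p + (-Complex.I * Complex.ofReal a * Complex.ofReal (Real.sin p.2.2) * dT u p
      + (m : ℂ) * (Complex.ofReal (Real.sin p.2.2))⁻¹ * u p)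
    + (n : ℂ) * Complex.ofReal (Real.cos p.2.2 / Real.sin p.2.2) * u p

/-- The ladder operator `Lₙ⁺`. -/
noncomputable def LladP (a : ℝ) (m n : ℤ) (u : F3) : F3 := fun p =>
  dTh u p - (-Complex.I * Complex.ofReal a * Complex.ofReal (Real.sin p.2.2) * dT u p
      + (m : ℂ) * (Complex.ofReal (Real.sin p.2.2))⁻¹ * u p)
    + (n : ℂ) * Complex.ofReal (Real.cos p.2.2 / Real.sin p.2.2) * u p

/-- `D² = D₁D₀⁺ + D₁⁺D₀`. -/
noncomputable def D2 (M a : ℝ) (m : ℤ) (u : F3) : F3 := fun p =>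
  Dlad M a m 1 (DladP M a m 0 u) p + DladP M a m 1 (Dlad M a m 0 u) p

/-- `L² = L₁L₀⁺ + L₁⁺L₀`. -/
noncomputable def L2 (a : ℝ) (m : ℤ) (u : F3) : F3 := fun p =>
  Llad a m 1 (LladP a m 0 u) p + LladP a m 1 (Llad a m 0 u) p

/-- The operator `P` appearing in the symmetry operator `S`. -/
noncomputable def Pop (M a : ℝ) (m : ℤ) (u : F3) : F3 := fun p =>
  -2 * Complex.I * (m : ℂ) * Complex.ofReal a
      * Complex.ofReal ((p.2.1 ^ 2 + a ^ 2) * Sig a p.2.1 p.2.2) * dT u p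
    - Complex.ofReal (a ^ 2 * Real.sin p.2.2 ^ 2 * Del M a p.2.1)
        * dR (fun q => Complex.ofReal (Del M a q.2.1) * dR u q) p
    - Complex.ofReal ((p.2.1 ^ 2 + a ^ 2) ^ 2 / Real.sin p.2.2)
        * dTh (fun q => Complex.ofReal (Real.sin q.2.2) * dTh u q) p
    + (m : ℂ) ^ 2 * Complex.ofReal (Sig a p.2.1 p.2.2 / Real.sin p.2.2 ^ 2
        * (Sig a p.2.1 p.2.2 + 2 * a ^ 2 * Real.sin p.2.2 ^ 2)) * u p

/-- The new first-order-in-time symmetry operator `S`. -/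
noncomputable def Sop (M a : ℝ) (m : ℤ) (u : F3) : F3 := fun p =>
  (Complex.ofReal ((p.2.1 ^ 2 + a ^ 2) * Sig a p.2.1 p.2.2
      + 2 * M * a ^ 2 * p.2.1 * Real.sin p.2.2 ^ 2))⁻¹ * Pop M a m u p

end

theorem isOpen_OmegaR (M a : ℝ) : IsOpen (OmegaR M a) := by
  simp only [OmegaR, Set.ofPred_and]
  exact (isOpen_lt (by fun_prop) (by fun_prop)).inter
    ((isOpen_lt (by fun_prop) (by fun_prop)).inter (isOpen_lt (by fun_prop) (by fun_prop)))

theorem Del_pos {M a r : ℝ} (ha : 0 ≤ a) (haM : a ≤ M) (hr : rplus M a < r) : 0 < Del M a r := by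
  have hnonneg : 0 ≤ M ^ 2 - a ^ 2 := by nlinarith
  have hsq := Real.sq_sqrt hnonneg
  have hsqrt := Real.sqrt_nonneg (M ^ 2 - a ^ 2)
  unfold rplus at hr
  unfold Del
  nlinarith

theorem dT_eq_fderiv {f : F3} {p : ℝ × ℝ × ℝ} (hf : DifferentiableAt ℝ f p) :
    dT f p = fderiv ℝ f p (1, 0, 0) :=
  (hf.hasFDerivAt.comp_hasDerivAt (f := fun s => (s, p.2.1, p.2.2)) p.1
    ((hasDerivAt_id _).prodMk ((hasDerivAt_const _ _).prodMk (hasDerivAt_const _ _)))).deriv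

theorem dR_eq_fderiv {f : F3} {p : ℝ × ℝ × ℝ} (hf : DifferentiableAt ℝ f p) :
    dR f p = fderiv ℝ f p (0, 1, 0) :=
  (hf.hasFDerivAt.comp_hasDerivAt (f := fun s => (p.1, s, p.2.2)) p.2.1
    ((hasDerivAt_const _ _).prodMk ((hasDerivAt_id _).prodMk (hasDerivAt_const _ _)))).deriv

theorem dTh_eq_fderiv {f : F3} {p : ℝ × ℝ × ℝ} (hf : DifferentiableAt ℝ f p) :
    dTh f p = fderiv ℝ f p (0, 0, 1) :=
  (hf.hasFDerivAt.comp_hasDerivAt (f := fun s => (p.1, p.2.1, s)) p.2.2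
    ((hasDerivAt_const _ _).prodMk ((hasDerivAt_const _ _).prodMk (hasDerivAt_id _)))).deriv

section Differentiability

variable {U : Set (ℝ × ℝ × ℝ)} {v : F3} {p : ℝ × ℝ × ℝ}

theorem differentiableAt_fderiv_apply_of_contDiffOn (hU : IsOpen U) (hv : ContDiffOn ℝ 2 v U)
    (hp : p ∈ U) (e : ℝ × ℝ × ℝ) : DifferentiableAt ℝ (fun q => fderiv ℝ v q e) p :=
  (((hv.fderiv_of_isOpen hU (m := 1) (by norm_num)).differentiableOn (by norm_num)).differentiableAt
    (hU.mem_nhds hp)).clm_apply (differentiableAt_const e)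

theorem eventually_differentiableAt_of_contDiffOn (hU : IsOpen U) (hv : ContDiffOn ℝ 2 v U)
    (hp : p ∈ U) : ∀ᶠ q in nhds p, DifferentiableAt ℝ v q := by
  filter_upwards [hU.mem_nhds hp] with q hq
  exact (hv.differentiableOn (by norm_num)).differentiableAt (hU.mem_nhds hq)

theorem differentiableAt_dT (hU : IsOpen U) (hv : ContDiffOn ℝ 2 v U) (hp : p ∈ U) :
    DifferentiableAt ℝ (dT v) p :=
  (differentiableAt_fderiv_apply_of_contDiffOn hU hv hp _).congr_of_eventuallyEq
    ((eventually_differentiableAt_of_contDiffOn hU hv hp).mono fun _ => dT_eq_fderiv)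

theorem differentiableAt_dR (hU : IsOpen U) (hv : ContDiffOn ℝ 2 v U) (hp : p ∈ U) :
    DifferentiableAt ℝ (dR v) p :=
  (differentiableAt_fderiv_apply_of_contDiffOn hU hv hp _).congr_of_eventuallyEq
    ((eventually_differentiableAt_of_contDiffOn hU hv hp).mono fun _ => dR_eq_fderiv)

theorem differentiableAt_dTh (hU : IsOpen U) (hv : ContDiffOn ℝ 2 v U) (hp : p ∈ U) :
    DifferentiableAt ℝ (dTh v) p :=
  (differentiableAt_fderiv_apply_of_contDiffOn hU hv hp _).congr_of_eventuallyEq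
    ((eventually_differentiableAt_of_contDiffOn hU hv hp).mono fun _ => dTh_eq_fderiv)

end Differentiability

theorem differentiableAt_ofReal_comp {E : Type*} [NormedAddCommGroup E] [NormedSpace ℝ E]
    {f : E → ℝ} {x : E} (hf : DifferentiableAt ℝ f x) :
    DifferentiableAt ℝ (fun y => (f y : ℂ)) x :=
  Complex.ofRealCLM.differentiableAt.comp x hf

section Calculus

variable {f g : F3} {p : ℝ × ℝ × ℝ}

theorem dT_add (hf : DifferentiableAt ℝ f p) (hg : DifferentiableAt ℝ g p) :
    dT (f + g) p = dT f p + dT g p := by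
  simp [dT_eq_fderiv, hf, hg, hf.add hg, fderiv_add]

theorem dT_sub (hf : DifferentiableAt ℝ f p) (hg : DifferentiableAt ℝ g p) :
    dT (f - g) p = dT f p - dT g p := by
  simp [dT_eq_fderiv, hf, hg, hf.sub hg, fderiv_sub]

theorem dR_add (hf : DifferentiableAt ℝ f p) (hg : DifferentiableAt ℝ g p) :
    dR (f + g) p = dR f p + dR g p := by
  simp [dR_eq_fderiv, hf, hg, hf.add hg, fderiv_add]

theorem dR_sub (hf : DifferentiableAt ℝ f p) (hg : DifferentiableAt ℝ g p) :
    dR (f - g) p = dR f p - dR g p := by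
  simp [dR_eq_fderiv, hf, hg, hf.sub hg, fderiv_sub]

theorem dTh_add (hf : DifferentiableAt ℝ f p) (hg : DifferentiableAt ℝ g p) :
    dTh (f + g) p = dTh f p + dTh g p := by
  simp [dTh_eq_fderiv, hf, hg, hf.add hg, fderiv_add]

theorem dTh_sub (hf : DifferentiableAt ℝ f p) (hg : DifferentiableAt ℝ g p) :
    dTh (f - g) p = dTh f p - dTh g p := by
  simp [dTh_eq_fderiv, hf, hg, hf.sub hg, fderiv_sub]

theorem dT_linear_comb (b c : ℝ × ℝ → ℂ) (hf : DifferentiableAt ℝ f p)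
    (hg : DifferentiableAt ℝ g p) :
    dT (fun q => b q.2 * f q + c q.2 * g q) p = b p.2 * dT f p + c p.2 * dT g p := by
  have slice {h : F3} (hh : DifferentiableAt ℝ h p) :
      DifferentiableAt ℝ (fun s => h (s, p.2.1, p.2.2)) p.1 :=
    DifferentiableAt.comp (f := fun s => (s, p.2.1, p.2.2)) p.1 hh (by fun_prop)
  exact (((slice hf).hasDerivAt.const_mul (b p.2)).add
    ((slice hg).hasDerivAt.const_mul (c p.2))).deriv

theorem dR_Del_mul (M a : ℝ) (hf : DifferentiableAt ℝ f p) :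
    dR (fun q => Complex.ofReal (Del M a q.2.1) * f q) p =
      Complex.ofReal (2 * (p.2.1 - M)) * f p + Complex.ofReal (Del M a p.2.1) * dR f p := by
  have slice : DifferentiableAt ℝ (fun s => f (p.1, s, p.2.2)) p.2.1 :=
    DifferentiableAt.comp (f := fun s => (p.1, s, p.2.2)) p.2.1 hf (by fun_prop)
  have hDel : HasDerivAt (Del M a) (2 * (p.2.1 - M)) p.2.1 := by
    have h := (((hasDerivAt_id p.2.1).pow 2).sub
      ((hasDerivAt_id p.2.1).const_mul (2 * M))).add_const (a ^ 2)
    exact h.congr_deriv (by simp; ring)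
  exact (hDel.ofReal_comp.mul slice.hasDerivAt).deriv

theorem dTh_sin_mul (hf : DifferentiableAt ℝ f p) :
    dTh (fun q => Complex.ofReal (Real.sin q.2.2) * f q) p =
      Complex.ofReal (Real.cos p.2.2) * f p + Complex.ofReal (Real.sin p.2.2) * dTh f p := by
  have slice : DifferentiableAt ℝ (fun s => f (p.1, p.2.1, s)) p.2.2 :=
    DifferentiableAt.comp (f := fun s => (p.1, p.2.1, s)) p.2.2 hf (by fun_prop)
  exact ((Real.hasDerivAt_sin p.2.2).ofReal_comp.mul slice.hasDerivAt).deriv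

end Calculus

theorem D2_eq {M a : ℝ} {m : ℤ} {v : F3} {U : Set (ℝ × ℝ × ℝ)} {p : ℝ × ℝ × ℝ}
    (hU : IsOpen U) (hv : ContDiffOn ℝ 2 v U) (hp : p ∈ U) (hΔ : Del M a p.2.1 ≠ 0) :
    D2 M a m v p =
      2 * (dR (dR v) p + Complex.ofReal (2 * (p.2.1 - M) / Del M a p.2.1) * dR v p
        - (Complex.ofReal (Del M a p.2.1) ^ 2)⁻¹ *
          (Complex.ofReal (p.2.1 ^ 2 + a ^ 2) ^ 2 * dT (dT v) p
            + 2 * Complex.I * m * a * Complex.ofReal (p.2.1 ^ 2 + a ^ 2) * dT v p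
            - (m : ℂ) ^ 2 * (a : ℂ) ^ 2 * v p)) := by
  have hv0 := (eventually_differentiableAt_of_contDiffOn hU hv hp).self_of_nhds
  have hT := differentiableAt_dT hU hv hp
  have hR := differentiableAt_dR hU hv hp
  let X : F3 := fun q => (Complex.ofReal (Del M a q.2.1))⁻¹ *
    (Complex.ofReal (q.2.1 ^ 2 + a ^ 2)) * dT v q +
      (Complex.ofReal (Del M a q.2.1))⁻¹ * (Complex.I * m * a) * v q
  have hX : DifferentiableAt ℝ X p := by
    have hDel : DifferentiableAt ℝ (fun q : ℝ × ℝ × ℝ => (Del M a q.2.1 : ℂ)) p :=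
      differentiableAt_ofReal_comp (f := fun q : ℝ × ℝ × ℝ => Del M a q.2.1) (by unfold Del; fun_prop)
    have hpoly : DifferentiableAt ℝ (fun q : ℝ × ℝ × ℝ => ((q.2.1 ^ 2 + a ^ 2 : ℝ) : ℂ)) p :=
      differentiableAt_ofReal_comp (f := fun q : ℝ × ℝ × ℝ => q.2.1 ^ 2 + a ^ 2) (by fun_prop)
    have hinv := hDel.inv (Complex.ofReal_ne_zero.mpr hΔ)
    exact ((hinv.mul hpoly).mul hT).add ((hinv.mul (differentiableAt_const _)).mul hv0)
  have hTX : dT X p = _ := dT_linear_comb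
    (fun x => (Complex.ofReal (Del M a x.1))⁻¹ * (Complex.ofReal (x.1 ^ 2 + a ^ 2)))
    (fun x => (Complex.ofReal (Del M a x.1))⁻¹ * (Complex.I * m * a)) hT hv0
  have hD0 : Dlad M a m 0 v = dR v + X := by
    funext q
    simp [Dlad, X]
    ring
  have hD0P : DladP M a m 0 v = dR v - X := by
    funext q
    simp [DladP, X]
    ring
  rw [D2, hD0, hD0P]
  simp only [Dlad, DladP, dR_add hR hX, dR_sub hR hX, dT_add hR hX, dT_sub hR hX, hTX,
    Pi.add_apply, Pi.sub_apply, X]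
  push_cast
  linear_combination (2 * (Complex.ofReal (Del M a p.2.1) ^ 2)⁻¹ * (m : ℂ) ^ 2 * (a : ℂ) ^ 2 * -v p)
    * Complex.I_sq

theorem L2_eq {a : ℝ} {m : ℤ} {v : F3} {U : Set (ℝ × ℝ × ℝ)} {p : ℝ × ℝ × ℝ}
    (hU : IsOpen U) (hv : ContDiffOn ℝ 2 v U) (hp : p ∈ U) (hsin : Real.sin p.2.2 ≠ 0) :
    L2 a m v p =
      2 * (dTh (dTh v) p + Complex.ofReal (Real.cos p.2.2 / Real.sin p.2.2) * dTh v p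
        + (a : ℂ) ^ 2 * Complex.ofReal (Real.sin p.2.2) ^ 2 * dT (dT v) p
        + 2 * Complex.I * m * a * dT v p
        - (m : ℂ) ^ 2 * (Complex.ofReal (Real.sin p.2.2) ^ 2)⁻¹ * v p) := by
  have hv0 := (eventually_differentiableAt_of_contDiffOn hU hv hp).self_of_nhds
  have hT := differentiableAt_dT hU hv hp
  have hTh := differentiableAt_dTh hU hv hp
  let Y : F3 := fun q => -Complex.I * a * Complex.ofReal (Real.sin q.2.2) * dT v q +
      m * (Complex.ofReal (Real.sin q.2.2))⁻¹ * v q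
  have hsin' := Complex.ofReal_ne_zero.mpr hsin
  have hY : DifferentiableAt ℝ Y p := by
    have hs : DifferentiableAt ℝ (fun q : ℝ × ℝ × ℝ => (Real.sin q.2.2 : ℂ)) p :=
      differentiableAt_ofReal_comp (f := fun q : ℝ × ℝ × ℝ => Real.sin q.2.2) (by fun_prop)
    exact ((hs.const_mul _).mul hT).add (((hs.inv hsin').const_mul _).mul hv0)
  have hTY : dT Y p = _ := dT_linear_comb
    (fun x => -Complex.I * a * Complex.ofReal (Real.sin x.2))
    (fun x => m * (Complex.ofReal (Real.sin x.2))⁻¹) hT hv0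
  have hL0 : Llad a m 0 v = dTh v + Y := by
    funext q
    simp [Llad, Y]
  have hL0P : LladP a m 0 v = dTh v - Y := by
    funext q
    simp [LladP, Y]
  rw [L2, hL0, hL0P]
  simp only [Llad, LladP, dTh_add hTh hY, dTh_sub hTh hY, dT_add hTh hY, dT_sub hTh hY, hTY,
    Pi.add_apply, Pi.sub_apply, Y]
  push_cast at hsin' ⊢
  field_simp
  linear_combination (-2 * Complex.sin p.2.2 ^ 4 * (a : ℂ) ^ 2 * dT (dT v) p) * Complex.I_sq

/-- `Sv = -(1/(2Σ̄))[a² sin²θ Δ D² + ((r²+a²)²/Δ) L²]v`,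
where `Σ̄ = (r²+a²)²/Δ - a² sin²θ`. -/
theorem Sop_ladder_rep (M a : ℝ) (m : ℤ) (hM : 0 < M) (ha : 0 ≤ a) (haM : a ≤ M)
    (v : F3) (hv : ContDiffOn ℝ 2 v (OmegaR M a)) :
    ∀ p ∈ OmegaR M a,
      Sop M a m v p =
        -(Complex.ofReal (2 * ((p.2.1 ^ 2 + a ^ 2) ^ 2 / Del M a p.2.1
            - a ^ 2 * Real.sin p.2.2 ^ 2)))⁻¹ *
          (Complex.ofReal (a ^ 2 * Real.sin p.2.2 ^ 2 * Del M a p.2.1) * D2 M a m v p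
            + Complex.ofReal ((p.2.1 ^ 2 + a ^ 2) ^ 2 / Del M a p.2.1) * L2 a m v p) := by
  intro p hp
  have hU := isOpen_OmegaR M a
  have hΔ := (Del_pos ha haM hp.1).ne'
  have hsin := (Real.sin_pos_of_pos_of_lt_pi hp.2.1 hp.2.2).ne'
  have hr : 0 < p.2.1 := (add_pos_of_pos_of_nonneg hM (Real.sqrt_nonneg _)).trans hp.1
  have hSig : Sig a p.2.1 p.2.2 = p.2.1 ^ 2 + a ^ 2 - a ^ 2 * Real.sin p.2.2 ^ 2 := by
    rw [Sig, Real.cos_sq']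
    ring
  have hden : (p.2.1 ^ 2 + a ^ 2) * Sig a p.2.1 p.2.2 + 2 * M * a ^ 2 * p.2.1 * Real.sin p.2.2 ^ 2
      = Del M a p.2.1 * ((p.2.1 ^ 2 + a ^ 2) ^ 2 / Del M a p.2.1
        - a ^ 2 * Real.sin p.2.2 ^ 2) := by
    rw [mul_sub, mul_div_cancel₀ _ hΔ, hSig, Del]
    ring
  have hpos : 0 < (p.2.1 ^ 2 + a ^ 2) * Sig a p.2.1 p.2.2
      + 2 * M * a ^ 2 * p.2.1 * Real.sin p.2.2 ^ 2 := by
    unfold Sig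
    positivity
  have hbar := right_ne_zero_of_mul (hden ▸ hpos.ne')
  rw [Sop, hden, Pop, D2_eq hU hv hp hΔ, L2_eq hU hv hp hsin,
    dR_Del_mul M a (differentiableAt_dR hU hv hp), dTh_sin_mul (differentiableAt_dTh hU hv hp),
    hSig]
  generalize hB : (p.2.1 ^ 2 + a ^ 2) ^ 2 / Del M a p.2.1 - a ^ 2 * Real.sin p.2.2 ^ 2 = B at hbar ⊢
  generalize Del M a p.2.1 = Δ at hΔ ⊢
  generalize Real.sin p.2.2 = s at hsin ⊢
  have hΔ' := Complex.ofReal_ne_zero.mpr hΔ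
  have hs' := Complex.ofReal_ne_zero.mpr hsin
  have hB' := Complex.ofReal_ne_zero.mpr hbar
  push_cast
  field_simp
  ring
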